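/- arXiv:1808.01705 — 2 statements merged into one kernel-verified Lean document; each statement's English description precedes it below -/
import Mathlib

section
/- Let F be a field of characteristic ≠ p with ζ_{p^k} ∈ F, ζ_{p^{k+1}} ∉ F (ζ₄ ∈ F if p = 2), m ≥ k, and a ∈ F^× with [a] ∉ ⟨[ζ_{p^k}]⟩ in F^×/(F^×)^p. Then F(a,m) := F(ζ_{p^m}, a^{1/p^m}) is Galois over F of degree p^{2m−k}, and Gal(F(a,m)/F) ≅ ⟨σ, τ ∣ τ^{p^m} = σ^{p^{m−k}} = 1, στσ⁻¹ = τ^{p^k+1}⟩ ≅ C_{p^m} ⋊ C_{p^{m−k}}, where τ fixes ζ_{p^m} and sends a^{1/p^m} to ζ_{p^m}·a^{1/p^m}, and σ fixes a^{1/p^m} and sends ζ_{p^m} to ζ_{p^m}^{p^k+1}. -/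
/-- Relators for the presentation ⟨σ, τ ∣ τ^(p^m) = σ^(p^(m-k)) = 1, στσ⁻¹ = τ^(p^k+1)⟩,
where `true` corresponds to σ and `false` to τ. -/
def demushkinRels (p m k : ℕ) : Set (FreeGroup Bool) :=
  { FreeGroup.of false ^ p ^ m,
    FreeGroup.of true ^ p ^ (m - k),
    FreeGroup.of true * FreeGroup.of false * (FreeGroup.of true)⁻¹ *
      (FreeGroup.of false ^ (p ^ k + 1))⁻¹ }

open Polynomial in
/-- If `(-1) ^ (p + 1)` is a `p`-th power (automatic for odd `p`, and meaning that `-1` is a square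
for `p = 2`), then `X ^ p ^ n - a` is irreducible as soon as `a` is not a `p`-th power. -/
theorem X_pow_prime_pow_sub_C_irreducible {p : ℕ} (hp : p.Prime) (n : ℕ) {E : Type*} [Field E]
    {a : E} (hneg : ∃ c : E, c ^ p = (-1) ^ (p + 1)) (ha : ∀ b : E, b ^ p ≠ a) :
    Irreducible (X ^ p ^ n - C a) := by
  induction n generalizing E a with
  | zero => simpa using irreducible_X_sub_C a
  | succ n ih =>
    rw [pow_succ]
    apply X_pow_mul_sub_C_irreducible (X_pow_sub_C_irreducible_of_prime hp ha)
    intro L _ _ x hx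
    obtain ⟨c, hc⟩ := hneg
    have hint : IsIntegral E x := not_not.mp fun h ↦ by
      simpa only [degree_zero, degree_X_pow_sub_C hp.pos,
        WithBot.natCast_ne_bot] using congr_arg degree (hx.symm.trans (dif_neg h))
    refine ih ⟨algebraMap E _ c, by rw [← map_pow, hc]; simp⟩ fun b hb ↦ ?_
    have hc0 : c ≠ 0 := by
      rintro rfl
      rw [zero_pow hp.ne_zero] at hc
      exact pow_ne_zero _ (neg_ne_zero.mpr one_ne_zero) hc.symm
    have hN : Algebra.norm E b ^ p = (-1) ^ (p + 1) * a := by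
      rw [← map_pow, hb, ← IntermediateField.adjoin.powerBasis_gen hint,
        Algebra.PowerBasis.norm_gen_eq_coeff_zero_minpoly]
      simp [IntermediateField.minpoly_gen, hx, hp.ne_zero.symm, pow_succ]
    apply ha (Algebra.norm E b / c)
    rw [div_pow, hN, hc, mul_div_cancel_left₀]
    exact pow_ne_zero _ (neg_ne_zero.mpr one_ne_zero)

theorem AlgEquiv.ext_of_adjoin_eq_top {F K : Type*} [Field F] [Field K] [Algebra F K] {S : Set K}
    (hS : IntermediateField.adjoin F S = ⊤) {g h : K ≃ₐ[F] K} (hgh : ∀ x ∈ S, g x = h x) :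
    g = h := by
  ext x
  have hx : x ∈ IntermediateField.adjoin F S := hS ▸ IntermediateField.mem_top
  induction hx using IntermediateField.adjoin_induction with
  | mem x hx => exact hgh x hx
  | algebraMap x => simp
  | add x y _ _ hx hy => simp [hx, hy]
  | inv x _ hx => simp [hx]
  | mul x y _ _ hx hy => simp [hx, hy]

open Polynomial in
theorem isGalois_of_adjoin_primitiveRoot_root {F K : Type*} [Field F] [Field K] [Algebra F K]
    {N : ℕ} (hN : (N : F) ≠ 0) {a : F} (ha : a ≠ 0) {ζ α : K} (hζ : IsPrimitiveRoot ζ N)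
    (hα : α ^ N = algebraMap F K a) (hadj : IntermediateField.adjoin F {ζ, α} = ⊤) :
    FiniteDimensional F K ∧ IsGalois F K := by
  have hN0 : 0 < N := Nat.pos_of_ne_zero (by rintro rfl; simp at hN)
  have hα0 : α ≠ 0 := by
    rintro rfl
    rw [zero_pow hN0.ne', eq_comm, map_eq_zero] at hα
    exact ha hα
  have hroot : ∀ x : K, x ^ N = algebraMap F K a → x ∈ (X ^ N - C a : F[X]).rootSet K := by
    intro x hx
    rw [mem_rootSet_of_ne (X_pow_sub_C_ne_zero hN0 a)]
    simp [hx]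
  have hsplit : (X ^ N - C a : F[X]).IsSplittingField F K := by
    rw [isSplittingField_iff_intermediateField]
    constructor
    · rw [Polynomial.map_sub, Polynomial.map_pow, Polynomial.map_C, Polynomial.map_X]
      exact X_pow_sub_C_splits_of_isPrimitiveRoot hζ hα
    · rw [eq_top_iff, ← hadj, IntermediateField.adjoin_le_iff]
      have h1 := IntermediateField.subset_adjoin F _ (hroot α hα)
      have h2 := IntermediateField.subset_adjoin F _
        (hroot (ζ * α) (by rw [mul_pow, hζ.pow_eq_one, one_mul, hα]))
      rintro x (rfl | rfl)
      · have := div_mem h2 h1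
        rwa [mul_div_cancel_right₀ _ hα0] at this
      · exact h1
  exact ⟨hsplit.finiteDimensional K _,
    IsGalois.of_separable_splitting_field (separable_X_pow_sub_C a hN ha)⟩

theorem AlgEquiv.pow_apply_eq_pow {F K : Type*} [Field F] [Field K] [Algebra F K] {σ : K ≃ₐ[F] K}
    {ζ : K} {r : ℕ} (h : σ ζ = ζ ^ r) (n : ℕ) : (σ ^ n) ζ = ζ ^ r ^ n := by
  induction n with
  | zero => simp
  | succ n ih => rw [pow_succ', AlgEquiv.mul_apply, ih, map_pow, h, ← pow_mul, pow_succ']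

/-- The order of an automorphism determined by its action `ζ ↦ ζ ^ (p ^ k + 1)` on a primitive
`p ^ m`-th root of unity. -/
theorem AlgEquiv.orderOf_eq_of_apply_primitiveRoot {F K : Type*} [Field F] [Field K] [Algebra F K]
    {p k m : ℕ} (hp : p.Prime) (hk : 1 ≤ k) (hk2 : p = 2 → 2 ≤ k) (hm : k ≤ m) {ζ : K}
    (hζ : IsPrimitiveRoot ζ (p ^ m)) {σ : K ≃ₐ[F] K} (hσ : σ ζ = ζ ^ (p ^ k + 1))
    (hfaithful : ∀ n : ℕ, (σ ^ n) ζ = ζ → σ ^ n = 1) :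
    orderOf σ = p ^ (m - k) := by
  have hpk : k + 2 ≤ p * k := by
    rcases hp.two_le.eq_or_lt with h | h
    · have := hk2 h.symm
      subst h
      omega
    · nlinarith
  have h := ZMod.orderOf_one_add_mul_prime_pow hp k (by omega) hpk 1
    (by simpa using (Nat.prime_iff_prime_int.mp hp).not_dvd_one) (m - k)
  rw [← h, orderOf_eq_orderOf_iff]
  intro n
  rw [Nat.sub_add_cancel hm]
  have hcast : ((1 : ZMod (p ^ m)) + (p : ZMod (p ^ m)) ^ k * ((1 : ℤ) : ZMod (p ^ m))) ^ n
      = (((p ^ k + 1) ^ n : ℕ) : ZMod (p ^ m)) := by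
    push_cast
    ring
  rw [hcast, ← Nat.cast_one (R := ZMod (p ^ m)), ZMod.natCast_eq_natCast_iff]
  have key : ζ ^ (p ^ k + 1) ^ n = ζ ↔ (p ^ k + 1) ^ n ≡ 1 [MOD p ^ m] := by
    obtain ⟨u, rfl⟩ := hζ.isUnit (pow_ne_zero _ hp.ne_zero)
    have h := pow_eq_pow_iff_modEq (x := u) (n := (p ^ k + 1) ^ n) (m := 1)
    rw [← (IsPrimitiveRoot.coe_units_iff.mp hζ).eq_orderOf, pow_one] at h
    rw [← h, ← Units.val_pow_eq_pow_val, Units.val_inj]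
  rw [← key, ← AlgEquiv.pow_apply_eq_pow hσ]
  exact ⟨fun h ↦ by rw [h]; rfl, hfaithful n⟩

section Cyclotomic

variable {p k m : ℕ} {F : Type*} [Field F] {ζk : F} {L : Type*} [Field L] [Algebra F L] {ζ : L}

theorem IsPrimitiveRoot.exists_pow_eq_neg_one_pow (hp : p.Prime) (hk : 1 ≤ k)
    (hk2 : p = 2 → 2 ≤ k) (hζk : IsPrimitiveRoot ζk (p ^ k)) :
    ∃ c : F, c ^ p = (-1) ^ (p + 1) := by
  rcases hp.eq_two_or_odd' with rfl | hodd
  · have hk' := hk2 rfl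
    have h2 : IsPrimitiveRoot (ζk ^ 2 ^ (k - 1)) 2 := by
      refine hζk.pow (by positivity) ?_
      rw [← pow_succ, Nat.sub_add_cancel hk]
    refine ⟨ζk ^ 2 ^ (k - 2), ?_⟩
    rw [← pow_mul, ← pow_succ, show k - 2 + 1 = k - 1 by omega, h2.eq_neg_one_of_two_right]
    norm_num
  · exact ⟨1, by rw [one_pow, hodd.add_one.neg_one_pow]⟩

theorem IsPrimitiveRoot.pow_ne_of_forall_not (hp : p.Prime) (hk : 1 ≤ k)
    (hnok1 : ¬ ∃ ζ : F, IsPrimitiveRoot ζ (p ^ (k + 1))) {z : F}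
    (hz : IsPrimitiveRoot z (p ^ k)) (f : F) : f ^ p ≠ z := by
  intro hf
  have := Fact.mk hp
  refine hnok1 ⟨f, IsPrimitiveRoot.iff_orderOf.mpr (orderOf_eq_prime_pow ?_ ?_)⟩
  · obtain ⟨j, rfl⟩ : ∃ j, k = j + 1 := ⟨k - 1, by omega⟩
    rw [pow_succ', pow_mul, hf]
    exact hz.pow_ne_one_of_pos_of_lt (pow_ne_zero _ hp.ne_zero)
      (Nat.pow_lt_pow_right hp.one_lt (by omega))
  · rw [pow_succ', pow_mul, hf, hz.pow_eq_one]

theorem IsPrimitiveRoot.exists_pow_eq_algebraMap (hp : p.Prime)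
    (hζk : IsPrimitiveRoot ζk (p ^ k)) (hm : k ≤ m) (hζ : IsPrimitiveRoot ζ (p ^ m)) :
    ∃ i : ℕ, ζ ^ p ^ (m - k) = algebraMap F L (ζk ^ i) ∧ IsPrimitiveRoot (ζk ^ i) (p ^ k) := by
  have hz : IsPrimitiveRoot (ζ ^ p ^ (m - k)) (p ^ k) :=
    hζ.pow (pow_pos hp.pos _) (by rw [← pow_add, Nat.sub_add_cancel hm])
  have := NeZero.mk (pow_ne_zero k hp.ne_zero)
  obtain ⟨i, -, hi⟩ := (hζk.map_of_injective (algebraMap F L).injective).eq_pow_of_pow_eq_one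
    hz.pow_eq_one
  rw [← map_pow] at hi
  refine ⟨i, hi.symm, ?_⟩
  rw [← hi] at hz
  exact hz.of_map_of_injective (algebraMap F L).injective

open Polynomial in
theorem IsPrimitiveRoot.exists_minpoly_eq (hp : p.Prime) (hk : 1 ≤ k) (hk2 : p = 2 → 2 ≤ k)
    (hζk : IsPrimitiveRoot ζk (p ^ k))
    (hnok1 : ¬ ∃ ζ : F, IsPrimitiveRoot ζ (p ^ (k + 1))) (hm : k ≤ m)
    (hζ : IsPrimitiveRoot ζ (p ^ m)) :
    ∃ z : F, ζ ^ p ^ (m - k) = algebraMap F L z ∧ minpoly F ζ = X ^ p ^ (m - k) - C z := by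
  obtain ⟨i, hi, hprim⟩ := hζk.exists_pow_eq_algebraMap hp hm hζ
  refine ⟨_, hi, (minpoly.eq_of_irreducible_of_monic ?_ (by simp [hi]) ?_).symm⟩
  · exact X_pow_prime_pow_sub_C_irreducible hp _ (hζk.exists_pow_eq_neg_one_pow hp hk hk2)
      (hprim.pow_ne_of_forall_not hp hk hnok1)
  · exact monic_X_pow_sub_C _ (pow_ne_zero _ hp.ne_zero)

open Polynomial in
theorem IsPrimitiveRoot.finrank_adjoin (hp : p.Prime) (hk : 1 ≤ k) (hk2 : p = 2 → 2 ≤ k)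
    (hζk : IsPrimitiveRoot ζk (p ^ k))
    (hnok1 : ¬ ∃ ζ : F, IsPrimitiveRoot ζ (p ^ (k + 1))) (hm : k ≤ m)
    (hζ : IsPrimitiveRoot ζ (p ^ m)) :
    Module.finrank F (IntermediateField.adjoin F {ζ}) = p ^ (m - k) := by
  obtain ⟨z, -, hz⟩ := hζk.exists_minpoly_eq hp hk hk2 hnok1 hm hζ
  rw [IntermediateField.adjoin.finrank
    (hζ.isIntegral (pow_pos hp.pos _)).tower_top, hz, natDegree_X_pow_sub_C]

/-- The cyclotomic extension is cyclic, with generator `ζ ↦ ζ ^ (p ^ k + 1)`. -/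
theorem IsPrimitiveRoot.exists_algEquiv_generator (hp : p.Prime) (hk : 1 ≤ k)
    (hchar : (p : F) ≠ 0) (hk2 : p = 2 → 2 ≤ k) (hζk : IsPrimitiveRoot ζk (p ^ k))
    (hnok1 : ¬ ∃ ζ : F, IsPrimitiveRoot ζ (p ^ (k + 1))) (hm : k ≤ m)
    (hζ : IsPrimitiveRoot ζ (p ^ m)) (hadj : IntermediateField.adjoin F {ζ} = ⊤) :
    ∃ σ : L ≃ₐ[F] L, σ ζ = ζ ^ (p ^ k + 1) ∧
      ∀ x, σ x = x → x ∈ Set.range (algebraMap F L) := by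
  obtain ⟨hfin, hgal⟩ := isGalois_of_adjoin_primitiveRoot_root (N := p ^ m) (a := (1 : F))
    (by push_cast; exact pow_ne_zero _ hchar) one_ne_zero (α := 1) hζ (by simp) (by
      rw [eq_top_iff, ← hadj]
      exact IntermediateField.adjoin.mono _ _ _ (by simp))
  obtain ⟨z, hz, hmin⟩ := hζk.exists_minpoly_eq hp hk hk2 hnok1 hm hζ
  obtain ⟨σ, hσ⟩ := minpoly.exists_algEquiv_of_root' (K := F) (y := ζ) (x := ζ ^ (p ^ k + 1))
    (Algebra.IsAlgebraic.isAlgebraic ζ) (by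
      rw [hmin]
      have : ζ ^ ((p ^ k + 1) * p ^ (m - k)) = algebraMap F L z := by
        rw [add_mul, ← pow_add, Nat.add_sub_cancel' hm, one_mul, pow_add, hζ.pow_eq_one, one_mul,
          hz]
      simp [← pow_mul, this])
  refine ⟨σ, hσ, fun x hx ↦ ?_⟩
  have hord : orderOf σ = p ^ (m - k) := by
    refine AlgEquiv.orderOf_eq_of_apply_primitiveRoot hp hk hk2 hm hζ hσ fun n hn ↦ ?_
    exact AlgEquiv.ext_of_adjoin_eq_top hadj (by simpa using hn)
  have hrank : Module.finrank F L = p ^ (m - k) := by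
    rw [← hζk.finrank_adjoin hp hk hk2 hnok1 hm hζ, hadj, IntermediateField.finrank_top']
  have hgen : Subgroup.zpowers σ = ⊤ := by
    apply Subgroup.eq_top_of_card_eq
    rw [Nat.card_zpowers, hord, IsGalois.card_aut_eq_finrank, hrank]
  rw [IsGalois.mem_range_algebraMap_iff_fixed]
  intro g
  obtain ⟨n, rfl⟩ : ∃ n : ℕ, σ ^ n = g :=
    Submonoid.mem_powers_iff _ _ |>.mp (mem_powers_iff_mem_zpowers.mpr (hgen ▸ Subgroup.mem_top g))
  clear * - hx
  induction n with
  | zero => simp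
  | succ n ih => rw [pow_succ, AlgEquiv.mul_apply, hx, ih]

theorem IsPrimitiveRoot.pow_ne_algebraMap (hp : p.Prime) (hk : 1 ≤ k)
    (hchar : (p : F) ≠ 0) (hk2 : p = 2 → 2 ≤ k) (hζk : IsPrimitiveRoot ζk (p ^ k))
    (hnok1 : ¬ ∃ ζ : F, IsPrimitiveRoot ζ (p ^ (k + 1))) (hm : k ≤ m)
    (hζ : IsPrimitiveRoot ζ (p ^ m)) (hadj : IntermediateField.adjoin F {ζ} = ⊤)
    {a : F} (ha : a ≠ 0) (hna : ∀ (f : F) (b : ℤ), a ≠ f ^ p * ζk ^ b) (b : L) :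
    b ^ p ≠ algebraMap F L a := by
  intro hb
  obtain ⟨σ, hσ, hfix⟩ := hζk.exists_algEquiv_generator hp hk hchar hk2 hnok1 hm hζ hadj
  rcases hm.eq_or_lt with rfl | hlt
  · have hone : σ = 1 := AlgEquiv.ext_of_adjoin_eq_top hadj (by
      simp [hσ, pow_succ, hζ.pow_eq_one])
    obtain ⟨f, rfl⟩ := hfix b (by rw [hone]; rfl)
    rw [← map_pow] at hb
    exact hna f 0 (by simpa using ((algebraMap F L).injective hb).symm)
  obtain ⟨i, hi, -⟩ := hζk.exists_pow_eq_algebraMap hp hm hζ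
  have hb0 : b ≠ 0 := by
    rintro rfl
    rw [zero_pow hp.ne_zero, eq_comm, map_eq_zero] at hb
    exact ha hb
  set c := ζ ^ p ^ (m - k - 1) with hc
  have hcp : c ^ p = algebraMap F L (ζk ^ i) := by
    rw [hc, ← pow_mul, ← pow_succ, Nat.sub_add_cancel (by omega), hi]
  have hc0 : c ≠ 0 := pow_ne_zero _ (hζ.ne_zero (pow_ne_zero _ hp.ne_zero))
  have hω : IsPrimitiveRoot (c ^ p ^ k) p := by
    rw [hc, ← pow_mul, ← pow_add]
    refine hζ.pow (pow_pos hp.pos _) ?_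
    rw [← pow_succ]
    congr 1
    omega
  have hσc : σ c = c ^ p ^ k * c := by
    rw [← pow_succ, hc, map_pow, hσ, ← pow_mul, ← pow_mul, mul_comm]
  have := NeZero.mk hp.ne_zero
  obtain ⟨j, -, hj⟩ := hω.eq_pow_of_pow_eq_one (ξ := σ b / b) (by
    rw [div_pow, ← map_pow, hb, AlgEquiv.commutes, div_self]
    simpa using ha)
  obtain ⟨f, hf⟩ := hfix (b / c ^ j) (by
    have hσb : σ b = (c ^ p ^ k) ^ j * b := by rw [hj, div_mul_cancel₀ _ hb0]
    rw [map_div₀, map_pow, hσc, hσb, mul_pow]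
    exact mul_div_mul_left _ _ (pow_ne_zero _ (hω.ne_zero hp.ne_zero)))
  apply hna f (i * j : ℕ)
  apply (algebraMap F L).injective
  rw [map_mul, map_pow, hf, zpow_natCast, pow_mul, map_pow _ _ j, ← hcp, ← hb, div_pow,
    ← pow_mul c j p, ← pow_mul c p j, mul_comm p j, div_mul_cancel₀ _ (pow_ne_zero _ hc0)]

end Cyclotomic

section Presentation

/-- In a group generated by `s` and `t`, with `s` normalizing the cyclic group generated by `t`,
every element has the form `t ^ i * s ^ j`. -/
theorem exists_eq_pow_mul_pow_of_closure_eq_top {P : Type*} [Group P] {s t : P} {A B r : ℕ}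
    (hA : 0 < A) (hB : 0 < B) (ht : t ^ A = 1) (hs : s ^ B = 1) (hst : s * t * s⁻¹ = t ^ r)
    (hgen : Subgroup.closure {s, t} = ⊤) (x : P) :
    ∃ ij : Fin A × Fin B, t ^ (ij.1 : ℕ) * s ^ (ij.2 : ℕ) = x := by
  suffices h : ∃ i j : ℕ, t ^ i * s ^ j = x by
    obtain ⟨i, j, rfl⟩ := h
    refine ⟨(⟨i % A, Nat.mod_lt _ hA⟩, ⟨j % B, Nat.mod_lt _ hB⟩), ?_⟩
    simp only [← pow_eq_pow_mod _ ht, ← pow_eq_pow_mod _ hs]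
  have mul_t : ∀ y, (∃ i j : ℕ, t ^ i * s ^ j = y) → ∃ i j : ℕ, t ^ i * s ^ j = t * y := by
    rintro _ ⟨i, j, rfl⟩
    exact ⟨i + 1, j, by rw [pow_succ', mul_assoc]⟩
  have mul_s : ∀ y, (∃ i j : ℕ, t ^ i * s ^ j = y) → ∃ i j : ℕ, t ^ i * s ^ j = s * y := by
    rintro _ ⟨i, j, rfl⟩
    refine ⟨r * i, j + 1, ?_⟩
    rw [pow_mul, ← hst, conj_pow, pow_succ']
    group
  have mul_pow_of : ∀ g : P,
      (∀ y, (∃ i j : ℕ, t ^ i * s ^ j = y) → ∃ i j : ℕ, t ^ i * s ^ j = g * y) →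
      ∀ (n : ℕ) (y : P), (∃ i j : ℕ, t ^ i * s ^ j = y) →
        ∃ i j : ℕ, t ^ i * s ^ j = g ^ n * y := by
    intro g hg n
    induction n with
    | zero => simp
    | succ n ih =>
      intro y hy
      rw [pow_succ', mul_assoc]
      exact hg _ (ih y hy)
  have hinv : ∀ {g : P} {N : ℕ}, 0 < N → g ^ N = 1 → g⁻¹ = g ^ (N - 1) := by
    intro g N hN hg
    rw [inv_eq_iff_mul_eq_one, ← pow_succ', Nat.sub_add_cancel hN, hg]
  have hx : x ∈ Subgroup.closure {s, t} := hgen ▸ Subgroup.mem_top x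
  induction hx using Subgroup.closure_induction_left with
  | one => exact ⟨0, 0, by simp⟩
  | mul_left g hg y _ hy =>
    rcases hg with rfl | rfl
    exacts [mul_s y hy, mul_t y hy]
  | inv_mul_cancel g hg y _ hy =>
    rcases hg with rfl | rfl
    · rw [hinv hB hs]
      exact mul_pow_of _ mul_s _ y hy
    · rw [hinv hA ht]
      exact mul_pow_of _ mul_t _ y hy

theorem demushkin_exists_eq_pow_mul_pow {p m k : ℕ} (hp : 0 < p)
    (x : PresentedGroup (demushkinRels p m k)) :
    ∃ ij : Fin (p ^ m) × Fin (p ^ (m - k)),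
      (PresentedGroup.of false : PresentedGroup (demushkinRels p m k)) ^ (ij.1 : ℕ) *
        PresentedGroup.of true ^ (ij.2 : ℕ) = x := by
  have hrel : ∀ w ∈ demushkinRels p m k, PresentedGroup.mk (demushkinRels p m k) w = 1 :=
    fun w hw ↦ PresentedGroup.one_of_mem hw
  refine exists_eq_pow_mul_pow_of_closure_eq_top (r := p ^ k + 1) (pow_pos hp _) (pow_pos hp _)
    ?_ ?_ ?_ ?_ x
  · exact hrel _ (Or.inl rfl)
  · exact hrel _ (Or.inr (Or.inl rfl))
  · exact mul_inv_eq_one.mp (hrel _ (Or.inr (Or.inr rfl)))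
  · rw [← PresentedGroup.closure_range_of, Bool.range_eq, Set.pair_comm]

/-- A group of order `p ^ m * p ^ (m - k)` containing elements that satisfy the relations of the
presentation and whose products `t ^ i * s ^ j` are pairwise distinct is the presented group. -/
theorem nonempty_mulEquiv_presentedGroup_demushkinRels {p m k : ℕ} (hp : 0 < p) {G : Type*}
    [Group G] [Finite G] {s t : G} (ht : t ^ p ^ m = 1) (hs : s ^ p ^ (m - k) = 1)
    (hst : s * t * s⁻¹ = t ^ (p ^ k + 1)) (hcard : Nat.card G = p ^ m * p ^ (m - k))
    (hinj : Function.Injective fun ij : Fin (p ^ m) × Fin (p ^ (m - k)) ↦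
      t ^ (ij.1 : ℕ) * s ^ (ij.2 : ℕ)) :
    Nonempty (G ≃* PresentedGroup (demushkinRels p m k)) := by
  have hrels : ∀ w ∈ demushkinRels p m k,
      FreeGroup.lift (fun b : Bool ↦ if b then s else t) w = 1 := by
    rintro w (rfl | rfl | rfl)
    · simpa using ht
    · simpa using hs
    · simp [hst]
  let ψ := PresentedGroup.toGroup hrels
  have hψ : ∀ ij : Fin (p ^ m) × Fin (p ^ (m - k)),
      ψ (PresentedGroup.of false ^ (ij.1 : ℕ) * PresentedGroup.of true ^ (ij.2 : ℕ)) =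
        t ^ (ij.1 : ℕ) * s ^ (ij.2 : ℕ) := by
    intro ij
    simp [ψ, PresentedGroup.toGroup.of]
  have hbij := hinj.bijective_of_nat_card_le (by simp [hcard])
  refine ⟨(MulEquiv.ofBijective ψ ⟨fun x y hxy ↦ ?_, fun g ↦ ?_⟩).symm⟩
  · obtain ⟨i, rfl⟩ := demushkin_exists_eq_pow_mul_pow hp x
    obtain ⟨j, rfl⟩ := demushkin_exists_eq_pow_mul_pow hp y
    rw [hψ, hψ] at hxy
    rw [hinj hxy]
  · obtain ⟨ij, rfl⟩ := hbij.2 g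
    exact ⟨_, hψ ij⟩

end Presentation

open Polynomial in
/-- An automorphism of `F(ζ, α)` may be prescribed arbitrarily on `ζ` and `α`, among the roots of
`X ^ d - z` and `X ^ N - a`, once the degree of `F(ζ, α)` is `d * N`. -/
theorem exists_algEquiv_of_finrank_eq_mul {F K : Type*} [Field F] [Field K] [Algebra F K]
    [FiniteDimensional F K] [IsGalois F K] {d N : ℕ} {z a : F} {ζ α : K} (hd : 0 < d) (hN : 0 < N)
    (hζ : ζ ^ d = algebraMap F K z) (hα : α ^ N = algebraMap F K a)
    (hadj : IntermediateField.adjoin F {ζ, α} = ⊤) (hrank : Module.finrank F K = d * N)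
    {x y : K} (hx : x ^ d = algebraMap F K z) (hy : y ^ N = algebraMap F K a) :
    ∃ g : K ≃ₐ[F] K, g ζ = x ∧ g α = y := by
  classical
  let R := {x // x ∈ nthRootsFinset d (algebraMap F K z)}
  let S := {x // x ∈ nthRootsFinset N (algebraMap F K a)}
  let φ : (K ≃ₐ[F] K) → R × S := fun g ↦
    (⟨g ζ, (mem_nthRootsFinset hd _).mpr (by rw [← map_pow, hζ, AlgEquiv.commutes])⟩,
      ⟨g α, (mem_nthRootsFinset hN _).mpr (by rw [← map_pow, hα, AlgEquiv.commutes])⟩)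
  have hφ : Function.Injective φ := by
    intro g h hgh
    have hgh := Prod.ext_iff.mp hgh
    refine AlgEquiv.ext_of_adjoin_eq_top hadj ?_
    rintro x (rfl | rfl)
    exacts [congrArg Subtype.val hgh.1, congrArg Subtype.val hgh.2]
  have hroots : ∀ (n : ℕ) (c : K), (nthRootsFinset n c).card ≤ n := fun n c ↦ by
    rw [nthRootsFinset]
    exact (Multiset.toFinset_card_le _).trans (card_nthRoots n c)
  have hle : Nat.card (R × S) ≤ Nat.card (K ≃ₐ[F] K) := by
    rw [IsGalois.card_aut_eq_finrank, hrank, Nat.card_prod]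
    simp only [R, S, Nat.card_eq_fintype_card, Fintype.card_coe]
    exact Nat.mul_le_mul (hroots _ _) (hroots _ _)
  obtain ⟨g, hg⟩ := (hφ.bijective_of_nat_card_le hle).2
    (⟨x, (mem_nthRootsFinset hd _).mpr hx⟩, ⟨y, (mem_nthRootsFinset hN _).mpr hy⟩)
  have hg := Prod.ext_iff.mp hg
  exact ⟨g, congrArg Subtype.val hg.1, congrArg Subtype.val hg.2⟩

open Polynomial in
theorem finrank_adjoin_primitiveRoot_root {p k m : ℕ} {F K : Type*} [Field F] [Field K]
    [Algebra F K] (hp : p.Prime) (hk : 1 ≤ k) (hchar : (p : F) ≠ 0) (hk2 : p = 2 → 2 ≤ k)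
    {ζk : F} (hζk : IsPrimitiveRoot ζk (p ^ k))
    (hnok1 : ¬ ∃ ζ : F, IsPrimitiveRoot ζ (p ^ (k + 1))) (hm : k ≤ m) {a : F} (ha : a ≠ 0)
    (hna : ∀ (f : F) (b : ℤ), a ≠ f ^ p * ζk ^ b) {ζ α : K} (hζ : IsPrimitiveRoot ζ (p ^ m))
    (hα : α ^ p ^ m = algebraMap F K a) (hadj : IntermediateField.adjoin F {ζ, α} = ⊤) :
    Module.finrank F K = p ^ (m - k) * p ^ m := by
  let M := IntermediateField.adjoin F {ζ}
  let ζM : M := IntermediateField.AdjoinSimple.gen F ζ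
  have hζM : IsPrimitiveRoot ζM (p ^ m) :=
    IsPrimitiveRoot.of_map_of_injective (f := algebraMap M K) (by exact hζ)
      (algebraMap M K).injective
  have hMtop : IntermediateField.adjoin F {ζM} = ⊤ := by
    apply IntermediateField.lift_injective M
    rw [IntermediateField.lift_adjoin_simple, IntermediateField.lift_top]
    rfl
  have hirr : Irreducible (X ^ p ^ m - C (algebraMap F M a)) := by
    obtain ⟨c, hc⟩ := hζk.exists_pow_eq_neg_one_pow hp hk hk2
    refine X_pow_prime_pow_sub_C_irreducible hp m ⟨algebraMap F M c, ?_⟩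
      (hζk.pow_ne_algebraMap hp hk hchar hk2 hnok1 hm hζM hMtop ha hna)
    rw [← map_pow, hc]
    simp
  have hαM : α ^ p ^ m = algebraMap M K (algebraMap F M a) := by
    rw [hα, ← IsScalarTower.algebraMap_apply]
  have hmin := minpoly.eq_of_irreducible_of_monic (x := α) hirr (by simp [hαM])
    (monic_X_pow_sub_C _ (pow_ne_zero _ hp.ne_zero))
  have hint : IsIntegral M α := by
    refine IsIntegral.of_pow (pow_pos hp.pos m) ?_
    rw [hαM]
    exact isIntegral_algebraMap
  have htop : IntermediateField.adjoin M {α} = ⊤ := by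
    apply IntermediateField.restrictScalars_injective F
    rw [IntermediateField.adjoin_adjoin_left, Set.singleton_union, hadj,
      IntermediateField.restrictScalars_top]
  rw [← Module.finrank_mul_finrank F M K, hζk.finrank_adjoin hp hk hk2 hnok1 hm hζ,
    ← IntermediateField.finrank_top' (F := M) (E := K), ← htop,
    IntermediateField.adjoin.finrank hint, ← hmin, natDegree_X_pow_sub_C]

theorem stmt_12 (p k : ℕ) (hp : p.Prime) (hk : 1 ≤ k)
    (F : Type*) [Field F] (hchar : (p : F) ≠ 0) (hk2 : p = 2 → 2 ≤ k)
    (ζk : F) (hζk : IsPrimitiveRoot ζk (p ^ k))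
    (hnok1 : ¬ ∃ ζ : F, IsPrimitiveRoot ζ (p ^ (k + 1)))
    (a : F) (ha : a ≠ 0)
    (hna : ∀ (f : F) (b : ℤ), a ≠ f ^ p * ζk ^ b)
    (m : ℕ) (hm : k ≤ m)
    (K : Type*) [Field K] [Algebra F K]
    (ζ : K) (hζ : IsPrimitiveRoot ζ (p ^ m))
    (α : K) (hα : α ^ p ^ m = algebraMap F K a)
    (hadj : IntermediateField.adjoin F {ζ, α} = ⊤) :
    IsGalois F K ∧ Module.finrank F K = p ^ (2 * m - k) ∧
    ∃ σ τ : K ≃ₐ[F] K,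
      τ ζ = ζ ∧ τ α = ζ * α ∧ σ α = α ∧ σ ζ = ζ ^ (p ^ k + 1) ∧
      τ ^ p ^ m = 1 ∧ σ ^ p ^ (m - k) = 1 ∧ σ * τ * σ⁻¹ = τ ^ (p ^ k + 1) ∧
      Nonempty ((K ≃ₐ[F] K) ≃* PresentedGroup (demushkinRels p m k)) := by
  have hrank := finrank_adjoin_primitiveRoot_root hp hk hchar hk2 hζk hnok1 hm ha hna hζ hα hadj
  obtain ⟨hfin, hgal⟩ := isGalois_of_adjoin_primitiveRoot_root (N := p ^ m)
    (by push_cast; exact pow_ne_zero _ hchar) ha hζ hα hadj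
  obtain ⟨i, hi, -⟩ := hζk.exists_pow_eq_algebraMap hp hm hζ
  have hext {g h : K ≃ₐ[F] K} (h1 : g ζ = h ζ) (h2 : g α = h α) : g = h := by
    refine AlgEquiv.ext_of_adjoin_eq_top hadj ?_
    rintro x (rfl | rfl)
    exacts [h1, h2]
  obtain ⟨τ, hτζ, hτα⟩ := exists_algEquiv_of_finrank_eq_mul (pow_pos hp.pos _) (pow_pos hp.pos _)
    hi hα hadj hrank (x := ζ) (y := ζ * α) hi (by rw [mul_pow, hζ.pow_eq_one, one_mul, hα])
  obtain ⟨σ, hσζ, hσα⟩ := exists_algEquiv_of_finrank_eq_mul (pow_pos hp.pos _) (pow_pos hp.pos _)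
    hi hα hadj hrank (x := ζ ^ (p ^ k + 1)) (y := α) (by
      rw [← pow_mul, add_mul, ← pow_add, Nat.add_sub_cancel' hm, one_mul, pow_add, hζ.pow_eq_one,
        one_mul, hi]) hα
  have hτζ' (n : ℕ) : (τ ^ n) ζ = ζ := by
    simpa using AlgEquiv.pow_apply_eq_pow (r := 1) (by simpa using hτζ) n
  have hσα' (n : ℕ) : (σ ^ n) α = α := by
    simpa using AlgEquiv.pow_apply_eq_pow (r := 1) (by simpa using hσα) n
  have hτα' (n : ℕ) : (τ ^ n) α = ζ ^ n * α := by
    induction n with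
    | zero => simp
    | succ n ih => rw [pow_succ', AlgEquiv.mul_apply, ih, map_mul, map_pow, hτζ, hτα, pow_succ,
        mul_assoc]
  have hα0 : α ≠ 0 := by
    rintro rfl
    rw [zero_pow (pow_ne_zero _ hp.ne_zero), eq_comm, map_eq_zero] at hα
    exact ha hα
  have hσord : orderOf σ = p ^ (m - k) :=
    AlgEquiv.orderOf_eq_of_apply_primitiveRoot hp hk hk2 hm hζ hσζ fun n hn ↦
      hext (by simpa using hn) (by simpa using hσα' n)
  have hτpow : τ ^ p ^ m = 1 :=
    hext (by simpa using hτζ' _) (by rw [hτα', hζ.pow_eq_one, one_mul, AlgEquiv.one_apply])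
  have hσpow : σ ^ p ^ (m - k) = 1 := hσord ▸ pow_orderOf_eq_one σ
  have hrel : σ * τ * σ⁻¹ = τ ^ (p ^ k + 1) := by
    rw [mul_inv_eq_iff_eq_mul]
    refine hext ?_ ?_
    · simp only [AlgEquiv.mul_apply, hτζ, hσζ, map_pow, hτζ']
    · simp only [AlgEquiv.mul_apply, hτα, hσα, map_mul, hσζ, hτα']
  refine ⟨hgal, ?_, σ, τ, hτζ, hτα, hσα, hσζ, hτpow, hσpow, hrel, ?_⟩
  · rw [hrank, ← pow_add]
    congr 1
    omega
  refine nonempty_mulEquiv_presentedGroup_demushkinRels hp.pos hτpow hσpow hrel ?_ ?_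
  · rw [IsGalois.card_aut_eq_finrank, hrank, mul_comm]
  · rintro ⟨i₁, j₁⟩ ⟨i₂, j₂⟩ h
    dsimp only at h
    have hi : i₁ = i₂ := by
      have hα := DFunLike.congr_fun h α
      simp only [AlgEquiv.mul_apply, hσα', hτα'] at hα
      exact Fin.ext (hζ.pow_inj i₁.2 i₂.2 (mul_right_cancel₀ hα0 hα))
    subst hi
    have hj : j₁ = j₂ := Fin.ext <| pow_injOn_Iio_orderOf (by simp [hσord])
      (by simp [hσord]) (mul_left_cancel h)
    rw [hj]
end

section
/- Let p be a prime, k ≥ 1 (k ≥ 2 if p = 2), m ≥ k, and G = ⟨σ, τ ∣ τ^{p^m} = σ^{p^{m−k}} = 1, στσ⁻¹ = τ^{p^k+1}⟩. Then the smallest n₀ with G^{(n₀)} = 1 is n₀ = m + 1, where G^{(i)} denotes the p-descending central series; and the smallest m₀ with G_{(m₀)} = 1, where G_{(n)} is the p-Zassenhaus filtration, is m₀ = p^{m−1} + 1. -/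
/-- The `p`-descending central series, indexed so that `pLowerCentral p G (n - 1) = G^(n)`:
`G^(1) = G`, `G^(i+1) = (G^(i))^p [G^(i), G]`. -/
def pLowerCentral (p : ℕ) (G : Type*) [Group G] : ℕ → Subgroup G
  | 0 => ⊤
  | n + 1 =>
      Subgroup.closure ((fun g => g ^ p) '' (pLowerCentral p G n : Set G)) ⊔
        ⁅pLowerCentral p G n, (⊤ : Subgroup G)⁆

/-- The `p`-Zassenhaus filtration: `G_(1) = G` and
`G_(n) = (G_(⌈n/p⌉))^p ∏_{i+j=n} [G_(i), G_(j)]` (as the subgroup generated by these). -/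
noncomputable def zassenhaus (p : ℕ) (hp : 2 ≤ p) (G : Type*) [Group G] (n : ℕ) : Subgroup G :=
  Nat.strongRecOn n (fun n ih =>
    if h : n ≤ 1 then ⊤
    else
      Subgroup.closure ((fun g => g ^ p) ''
        ((ih ((n + p - 1) / p) (by
          have hlt : n + p - 1 < n * p := by
            obtain ⟨a, rfl⟩ : ∃ a, n = a + 2 := ⟨n - 2, by omega⟩
            obtain ⟨b, rfl⟩ : ∃ b, p = b + 2 := ⟨p - 2, by omega⟩
            have hmul : (a + 2) * (b + 2) = a * b + 2 * a + 2 * b + 4 := by ring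
            omega
          exact (Nat.div_lt_iff_lt_mul (by omega)).mpr hlt) : Subgroup G) : Set G)) ⊔
      ⨆ (i : ℕ) (j : ℕ) (hij : i + j = n ∧ 0 < i ∧ 0 < j),
        ⁅ih i (by omega), ih j (by omega)⁆)

theorem zassenhaus_eq (p : ℕ) (hp : 2 ≤ p) (G : Type*) [Group G] (n : ℕ) (hn : 2 ≤ n) :
    zassenhaus p hp G n =
      Subgroup.closure ((fun g => g ^ p) '' (zassenhaus p hp G ((n + p - 1) / p) : Set G)) ⊔
      ⨆ (i : ℕ) (j : ℕ) (_ : i + j = n ∧ 0 < i ∧ 0 < j),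
        ⁅zassenhaus p hp G i, zassenhaus p hp G j⁆ := by
  conv_lhs => rw [zassenhaus, Nat.strongRecOn_eq, dif_neg (by omega)]
  rfl

theorem zassenhaus_of_le_one (p : ℕ) (hp : 2 ≤ p) (G : Type*) [Group G] (n : ℕ) (hn : n ≤ 1) :
    zassenhaus p hp G n = ⊤ := by
  rw [zassenhaus, Nat.strongRecOn_eq, dif_pos hn]

theorem pow_mem_pLowerCentral (p : ℕ) {G : Type*} [Group G] (g : G) (j : ℕ) :
    g ^ p ^ j ∈ pLowerCentral p G j := by
  induction j with
  | zero => exact Subgroup.mem_top _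
  | succ j ih =>
    refine Subgroup.mem_sup_left (Subgroup.subset_closure ⟨_, ih, ?_⟩)
    rw [pow_succ, pow_mul]

theorem pow_mem_zassenhaus (p : ℕ) (hp : 2 ≤ p) {G : Type*} [Group G] (g : G) (j n : ℕ)
    (hn : n ≤ p ^ j) : g ^ p ^ j ∈ zassenhaus p hp G n := by
  induction j generalizing n with
  | zero =>
    rw [zassenhaus_of_le_one p hp G n (by simpa using hn)]
    exact Subgroup.mem_top _
  | succ j ih =>
    rcases Nat.lt_or_ge 1 n with h | h
    · rw [zassenhaus_eq p hp G n h]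
      refine Subgroup.mem_sup_left (Subgroup.subset_closure ⟨_, ih _ ?_, ?_⟩)
      · rw [← Nat.lt_succ_iff, Nat.div_lt_iff_lt_mul (by omega), Nat.succ_mul, ← pow_succ]
        omega
      · rw [pow_succ, pow_mul]
    · rw [zassenhaus_of_le_one p hp G n h]
      exact Subgroup.mem_top _

/-- The `p`-Zassenhaus filtration lies in the `p`-descending central series, after the
logarithmic change of index. -/
theorem zassenhaus_le_pLowerCentral (p : ℕ) (hp : 2 ≤ p) (G : Type*) [Group G] (n j : ℕ)
    (hj : p ^ j < p * n) : zassenhaus p hp G n ≤ pLowerCentral p G j := by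
  induction n using Nat.strong_induction_on generalizing j with
  | _ n ih =>
  cases j with
  | zero => exact le_top
  | succ j =>
    have hjn : p ^ j < n := by
      rw [pow_succ, mul_comm] at hj
      exact Nat.lt_of_mul_lt_mul_left hj
    have hpos : 0 < p ^ j := by positivity
    rw [zassenhaus_eq p hp G n (by omega)]
    refine sup_le_sup (Subgroup.closure_mono (Set.image_mono ?_)) ?_
    · have hlt : (n + p - 1) / p < n := by
        rw [Nat.div_lt_iff_lt_mul (by omega)]
        nlinarith [Nat.sub_le (n + p) 1, Nat.sub_add_cancel (show 1 ≤ n + p by omega)]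
      refine ih _ hlt j ?_
      have h1 := Nat.div_add_mod (n + p - 1) p
      have h2 := Nat.mod_lt (n + p - 1) (show p > 0 by omega)
      omega
    · refine iSup_le fun a => iSup_le fun b => iSup_le fun ⟨hab, ha, hb⟩ => ?_
      rcases le_total b a with h | h
      · exact Subgroup.commutator_mono (ih a (by omega) j (by nlinarith)) le_top
      · rw [Subgroup.commutator_comm]
        exact Subgroup.commutator_mono (ih b (by omega) j (by nlinarith)) le_top

theorem dvd_geom_sum {p : ℕ} {x : ℤ} (hx : (p : ℤ) ∣ x - 1) :
    (p : ℤ) ∣ ∑ i ∈ Finset.range p, x ^ i := by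
  have : (p : ℤ) ∣ ∑ i ∈ Finset.range p, (x ^ i - 1) :=
    Finset.dvd_sum fun i _ => hx.trans (sub_one_dvd_pow_sub_one _ i)
  simpa [Finset.sum_sub_distrib] using this

theorem pow_add_dvd_pow_pow_sub_one {p k : ℕ} (hk : k ≠ 0) {x : ℤ} (hx : (p : ℤ) ^ k ∣ x - 1)
    (j : ℕ) : (p : ℤ) ^ (k + j) ∣ x ^ p ^ j - 1 := by
  induction j with
  | zero => simpa using hx
  | succ j ih =>
    rw [pow_succ, pow_mul, ← mul_geom_sum, ← add_assoc, pow_succ]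
    exact mul_dvd_mul ih (dvd_geom_sum ((dvd_pow_self _ (by omega)).trans ih))

section Metacyclic

variable {G : Type*} [Group G] {s t : G} {u : ℕ}

theorem pow_mul_zpow_of_conj (h : s * t * s⁻¹ = t ^ u) (a : ℕ) (b : ℤ) :
    s ^ a * t ^ b = t ^ (b * (u : ℤ) ^ a) * s ^ a := by
  induction a generalizing b with
  | zero => simp
  | succ a ih =>
    have hs : s * t ^ b = t ^ (b * (u : ℤ)) * s := by
      rw [← mul_inv_eq_iff_eq_mul, ← conj_zpow, h, ← zpow_natCast, ← zpow_mul, mul_comm]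
    rw [pow_succ, mul_assoc, hs, ← mul_assoc, ih, mul_assoc, mul_assoc, pow_succ' (u : ℤ)]

theorem zpow_mul_pow_mul (h : s * t * s⁻¹ = t ^ u) (a c : ℕ) (b d : ℤ) :
    (t ^ b * s ^ a) * (t ^ d * s ^ c) = t ^ (b + d * (u : ℤ) ^ a) * s ^ (a + c) := by
  rw [mul_assoc, ← mul_assoc (s ^ a), pow_mul_zpow_of_conj h, mul_assoc, ← pow_add,
    ← mul_assoc, ← zpow_add]

theorem zpow_mul_pow_pow (h : s * t * s⁻¹ = t ^ u) (a : ℕ) (b : ℤ) (n : ℕ) :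
    (t ^ b * s ^ a) ^ n =
      t ^ (b * ∑ i ∈ Finset.range n, ((u : ℤ) ^ a) ^ i) * s ^ (n * a) := by
  induction n with
  | zero => simp
  | succ n ih =>
    rw [pow_succ, ih, zpow_mul_pow_mul h, Finset.sum_range_succ, mul_add, ← pow_mul,
      mul_comm a n, add_mul, one_mul]

/-- The elements `t ^ b * s ^ a` with `q ∣ a` and `q ∣ b`, as a subgroup. -/
def metacyclicSubgroup (h : s * t * s⁻¹ = t ^ u) {N : ℕ} (hN : 0 < N) (hs : s ^ N = 1) (q : ℕ) :
    Subgroup G where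
  carrier := {g | ∃ (a : ℕ) (b : ℤ), q ∣ a ∧ (q : ℤ) ∣ b ∧ g = t ^ b * s ^ a}
  one_mem' := ⟨0, 0, by simp⟩
  mul_mem' := by
    rintro _ _ ⟨a, b, ha, hb, rfl⟩ ⟨c, d, hc, hd, rfl⟩
    exact ⟨_, _, ha.add hc, dvd_add hb (hd.mul_right _), zpow_mul_pow_mul h a c b d⟩
  inv_mem' := by
    rintro _ ⟨a, b, ha, hb, rfl⟩
    refine ⟨(N - 1) * a, -b * (u : ℤ) ^ ((N - 1) * a), ha.mul_left _,
      (hb.neg_right).mul_right _, ?_⟩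
    rw [← pow_mul_zpow_of_conj h, mul_inv_rev, zpow_neg]
    congr 1
    rw [inv_eq_iff_mul_eq_one, ← pow_add, add_comm, ← Nat.succ_mul,
      Nat.succ_eq_add_one, Nat.sub_add_cancel hN, pow_mul, hs, one_pow]

theorem pLowerCentral_le_metacyclicSubgroup {p : ℕ} (h : s * t * s⁻¹ = t ^ u) {N : ℕ}
    (hN : 0 < N) (hs : s ^ N = 1) (hgen : Subgroup.closure {s, t} = ⊤)
    (hu : (p : ℤ) ∣ u - 1) (j : ℕ) :
    pLowerCentral p G j ≤ metacyclicSubgroup h hN hs (p ^ j) := by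
  have hdvd (e : ℕ) : (p : ℤ) ∣ (u : ℤ) ^ e - 1 := hu.trans (sub_one_dvd_pow_sub_one _ e)
  have htop (g : G) : ∃ (a : ℕ) (b : ℤ), g = t ^ b * s ^ a := by
    have : g ∈ metacyclicSubgroup h hN hs 1 := by
      have hle : Subgroup.closure {s, t} ≤ metacyclicSubgroup h hN hs 1 := by
        rw [Subgroup.closure_le]
        rintro _ (rfl | rfl)
        · exact ⟨1, 0, by simp⟩
        · exact ⟨0, 1, by simp⟩
      exact hle (hgen ▸ Subgroup.mem_top g)
    obtain ⟨a, b, -, -, rfl⟩ := this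
    exact ⟨a, b, rfl⟩
  induction j with
  | zero =>
    intro g _
    obtain ⟨a, b, rfl⟩ := htop g
    exact ⟨a, b, by simp⟩
  | succ j ih =>
    refine sup_le ?_ ?_
    · rw [Subgroup.closure_le]
      rintro _ ⟨g, hg, rfl⟩
      obtain ⟨a, b, ha, hb, rfl⟩ := ih hg
      refine ⟨_, _, ?_, ?_, zpow_mul_pow_pow h a b p⟩
      · rw [pow_succ']
        exact mul_dvd_mul_left p ha
      · push_cast at hb ⊢
        rw [pow_succ]
        refine mul_dvd_mul hb ?_
        exact dvd_geom_sum (hdvd a)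
    · rw [Subgroup.commutator_le]
      intro g hg k _
      obtain ⟨a, b, ⟨a, rfl⟩, hb, rfl⟩ := ih hg
      obtain ⟨c, d, rfl⟩ := htop k
      refine ⟨0, (b + d * (u : ℤ) ^ (p ^ j * a)) - (d + b * (u : ℤ) ^ c), by simp, ?_, ?_⟩
      · have e : (b + d * (u : ℤ) ^ (p ^ j * a)) - (d + b * (u : ℤ) ^ c) =
            d * ((u : ℤ) ^ (p ^ j * a) - 1) - b * ((u : ℤ) ^ c - 1) := by ring
        rw [e]
        push_cast at hb ⊢
        refine dvd_sub (Dvd.dvd.mul_left ?_ d) ?_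
        · have := dvd_sub_pow_of_dvd_sub (R := ℤ) (p := p) (a := (u : ℤ) ^ a) (b := 1)
            (by exact_mod_cast hdvd a) j
          rwa [one_pow, ← pow_mul, mul_comm a] at this
        · rw [pow_succ]
          exact mul_dvd_mul hb (hdvd c)
      · rw [commutatorElement_def, mul_assoc, ← mul_inv_rev, zpow_mul_pow_mul h,
          zpow_mul_pow_mul h, add_comm c, mul_inv_rev, zpow_sub]
        simp [mul_assoc]

end Metacyclic

theorem demushkin_pLowerCentral_eq_bot (p m k : ℕ) (hp : 0 < p) (hk : 1 ≤ k) :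
    pLowerCentral p (PresentedGroup (demushkinRels p m k)) m = ⊥ := by
  set s : PresentedGroup (demushkinRels p m k) := PresentedGroup.of true with hs
  set t : PresentedGroup (demushkinRels p m k) := PresentedGroup.of false with ht
  have hrel : s * t * s⁻¹ = t ^ (p ^ k + 1) := by
    have := PresentedGroup.one_of_mem (rels := demushkinRels p m k)
      (x := FreeGroup.of true * FreeGroup.of false * (FreeGroup.of true)⁻¹ *
        (FreeGroup.of false ^ (p ^ k + 1))⁻¹) (by simp [demushkinRels])
    simp only [map_mul, map_inv, map_pow, mul_inv_eq_one] at this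
    exact this
  have htm : t ^ p ^ m = 1 := by
    have := PresentedGroup.one_of_mem (rels := demushkinRels p m k)
      (x := FreeGroup.of false ^ p ^ m) (by simp [demushkinRels])
    simp only [map_pow] at this
    exact this
  have hsm : s ^ p ^ (m - k) = 1 := by
    have := PresentedGroup.one_of_mem (rels := demushkinRels p m k)
      (x := FreeGroup.of true ^ p ^ (m - k)) (by simp [demushkinRels])
    simp only [map_pow] at this
    exact this
  have hgen : Subgroup.closure {s, t} = ⊤ := by
    rw [← PresentedGroup.closure_range_of, Bool.range_eq, Set.pair_comm]
  rw [eq_bot_iff]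
  refine (pLowerCentral_le_metacyclicSubgroup hrel (pow_pos hp _) hsm hgen ?_ m).trans ?_
  · simpa using dvd_pow_self (p : ℤ) (by omega : k ≠ 0)
  · rintro _ ⟨a, b, ⟨a, rfl⟩, ⟨b, rfl⟩, rfl⟩
    have hsm' : s ^ p ^ m = 1 := by
      rw [← orderOf_dvd_iff_pow_eq_one] at hsm ⊢
      exact hsm.trans (pow_dvd_pow p (by omega))
    rw [zpow_mul, zpow_natCast, htm, pow_mul, hsm', one_zpow, one_pow, mul_one]
    exact Subgroup.mem_bot.2 rfl

/-- The order of `τ` is seen in the affine action on `ZMod (p ^ m)`, with `τ` acting as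
`x ↦ x + 1` and `σ` as multiplication by `p ^ k + 1`. -/
theorem demushkin_dvd_of_pow_eq_one (p m k : ℕ) (hp : 0 < p) (hk : 1 ≤ k) (hmk : k ≤ m) (n : ℕ)
    (h : (PresentedGroup.of false : PresentedGroup (demushkinRels p m k)) ^ n = 1) :
    p ^ m ∣ n := by
  have hu : ((p : ZMod (p ^ m)) ^ k + 1) ^ p ^ (m - k) = 1 := by
    have h1 : ((p : ℤ) ^ m) ∣ ((p : ℤ) ^ k + 1) ^ p ^ (m - k) - 1 := by
      have := pow_add_dvd_pow_pow_sub_one (p := p) (k := k) (x := (p : ℤ) ^ k + 1)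
        (by omega) (by simp) (m - k)
      rwa [Nat.add_sub_cancel' hmk] at this
    have h2 := (ZMod.intCast_zmod_eq_zero_iff_dvd _ (p ^ m)).2 (by exact_mod_cast h1)
    push_cast at h2
    exact sub_eq_zero.1 h2
  let v : (ZMod (p ^ m))ˣ := Units.ofPowEqOne _ _ hu (pow_pos hp _).ne'
  have hv : (v : ZMod (p ^ m)) = (p : ZMod (p ^ m)) ^ k + 1 := rfl
  have hvpow : v ^ p ^ (m - k) = 1 := Units.ext (by simpa [hv] using hu)
  let f : Bool → Equiv.Perm (ZMod (p ^ m)) :=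
    fun i => if i then MulAction.toPermHom _ _ v else Equiv.addRight 1
  have hadd (n : ℕ) : f false ^ n = Equiv.addRight (n : ZMod (p ^ m)) := by
    simp [f]
  have hf : ∀ r ∈ demushkinRels p m k, FreeGroup.lift f r = 1 := by
    rintro r (rfl | rfl | rfl)
    · rw [map_pow, FreeGroup.lift_apply_of, hadd]
      ext x
      simp
    · rw [map_pow, FreeGroup.lift_apply_of]
      simp only [f, if_true]
      rw [← map_pow, hvpow, map_one]
    · simp only [map_mul, map_inv, map_pow, FreeGroup.lift_apply_of, mul_inv_eq_one]
      rw [mul_inv_eq_iff_eq_mul, hadd]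
      ext x
      simp [f, hv, Units.smul_def]
  have h3 := congrArg (PresentedGroup.toGroup hf) h
  rw [map_pow, PresentedGroup.toGroup.of, map_one, hadd] at h3
  have h4 := congrArg (fun e : Equiv.Perm (ZMod (p ^ m)) => e 0) h3
  exact (ZMod.natCast_eq_zero_iff n _).1 (by simpa using h4)

theorem stmt_15 (p m k : ℕ) (hp : p.Prime) (hk : 1 ≤ k) (hk2 : p = 2 → 2 ≤ k)
    (hmk : k ≤ m) :
    IsLeast {n : ℕ | 1 ≤ n ∧
        pLowerCentral p (PresentedGroup (demushkinRels p m k)) (n - 1) = ⊥} (m + 1) ∧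
    IsLeast {n : ℕ | 1 ≤ n ∧
        zassenhaus p hp.two_le (PresentedGroup (demushkinRels p m k)) n = ⊥}
      (p ^ (m - 1) + 1) := by
  have hbot := demushkin_pLowerCentral_eq_bot p m k hp.pos hk
  have hord (j : ℕ) (h : (PresentedGroup.of false : PresentedGroup (demushkinRels p m k)) ^
      p ^ j = 1) : m ≤ j :=
    (Nat.pow_dvd_pow_iff_le_right hp.one_lt).1
      (demushkin_dvd_of_pow_eq_one p m k hp.pos hk hmk _ h)
  refine ⟨⟨⟨by omega, hbot⟩, ?_⟩, ⟨⟨by omega, ?_⟩, ?_⟩⟩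
  · rintro n ⟨hn, h⟩
    have := hord (n - 1) (Subgroup.mem_bot.1 (h ▸ pow_mem_pLowerCentral p _ (n - 1)))
    omega
  · rw [eq_bot_iff, ← hbot]
    refine zassenhaus_le_pLowerCentral p hp.two_le _ _ m ?_
    rw [mul_add, mul_pow_sub_one (by omega)]
    exact Nat.lt_add_of_pos_right (by simpa using hp.pos)
  · rintro n ⟨-, h⟩
    by_contra! hlt
    have := hord (m - 1) (Subgroup.mem_bot.1
      (h ▸ pow_mem_zassenhaus p hp.two_le _ (m - 1) n (Nat.lt_succ_iff.1 hlt)))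
    omega
end
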